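/- Let n be a positive integer, 1 ≤ d ≤ n, α > 0, and let X = {x_j : j ∈ ℕ} ⊂ ℝⁿ be a set of distinct points with separation δ = inf_{j ≠ k} |x_j − x_k| > 0 whose linear span has dimension d. Then for every square-summable complex sequence (a_j), Σ_{j,k ∈ ℕ} 𝓜_α(|x_j − x_k|) |a_j| |a_k| ≤ (1 + d·2^{d−1}(5^d − 1) Γ(α + d/2) Γ(d/2) / (δ^d Γ(α))) · Σ_{j ∈ ℕ} |a_j|². -/

import Mathlib

open MeasureTheory Real Set

/-- The modified Bessel function of the second kind, via Schläfli's integral. -/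
noncomputable def matK (a z : ℝ) : ℝ :=
  (1 / 2) * ∫ t : ℝ, Real.exp (-z * Real.cosh t - a * t)

/-- The normalized Matérn function `𝓜_α`, with `𝓜_α(0) = 1`. -/
noncomputable def matern (a z : ℝ) : ℝ :=
  if z = 0 then 1 else ((2 : ℝ) ^ (1 - a) / Real.Gamma a) * matK a z * z ^ a

/-! ### Volume packing -/

lemma shell_pow_bounds (e : ℕ) {m : ℝ} (hm : 1 ≤ m) :
    (2 * m + 3) ^ (e + 1) - (2 * m - 1) ^ (e + 1) ≤ m ^ e * (5 ^ (e + 1) - 1) ∧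
      (2 * m + 3) ^ (e + 1) + (2 * m - 1) ^ (e + 1) ≤ m ^ (e + 1) * (5 ^ (e + 1) + 1) := by
  induction e with
  | zero =>
    refine ⟨by norm_num, ?_⟩
    norm_num
    linarith
  | succ e ih =>
    obtain ⟨h₁, h₂⟩ := ih
    set A := (2 * m + 3) ^ (e + 1)
    set B := (2 * m - 1) ^ (e + 1)
    set P : ℝ := 5 ^ (e + 1)
    have hA : (2 * m + 3) ^ (e + 1 + 1) = (2 * m + 3) * A := by rw [pow_succ']
    have hB : (2 * m - 1) ^ (e + 1 + 1) = (2 * m - 1) * B := by rw [pow_succ']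
    have hP : (5 : ℝ) ^ (e + 1 + 1) = 5 * P := by rw [pow_succ']
    have hP1 : 1 ≤ P := one_le_pow₀ (by norm_num)
    have hme : 0 ≤ m ^ e := by positivity
    have hD : 0 ≤ A - B :=
      sub_nonneg.2 (pow_le_pow_left₀ (by linarith) (by linarith) _)
    have hS : 0 ≤ A + B := add_nonneg (by positivity) (pow_nonneg (by linarith) _)
    have e₁ : m ^ (e + 1) = m * m ^ e := by rw [pow_succ']
    have e₂ : m ^ (e + 1 + 1) = m * (m * m ^ e) := by rw [pow_succ', e₁]
    rw [hA, hB, hP, e₂, e₁]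
    rw [e₁] at h₂
    constructor
    · calc (2 * m + 3) * A - (2 * m - 1) * B = (2 * m + 1) * (A - B) + 2 * (A + B) := by ring
        _ ≤ 3 * m * (m ^ e * (P - 1)) + 2 * (m * m ^ e * (P + 1)) := by
            gcongr
            linarith
        _ = m * m ^ e * (5 * P - 1) := by ring
    · calc (2 * m + 3) * A + (2 * m - 1) * B = (2 * m + 1) * (A + B) + 2 * (A - B) := by ring
        _ ≤ 3 * m * (m * m ^ e * (P + 1)) + 2 * (m * m * (m ^ e * (P - 1))) := by
            gcongr
            · linarith
            · refine h₁.trans (le_mul_of_one_le_left ?_ (by nlinarith))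
              exact mul_nonneg hme (by linarith)
        _ = m * (m * m ^ e) * (5 * P + 1) := by ring

lemma card_shell_le {E : Type*} [NormedAddCommGroup E] [NormedSpace ℝ E] [FiniteDimensional ℝ E]
    {e : ℕ} (hE : Module.finrank ℝ E = e + 1) {y : ℕ → E} {δ : ℝ} (hδ : 0 < δ)
    (hsep : ∀ j k, j ≠ k → δ ≤ ‖y j - y k‖) (p : E) {m : ℕ} (hm : 1 ≤ m) (S : Finset ℕ)
    (hS : ∀ k ∈ S, m * δ ≤ ‖y k - p‖ ∧ ‖y k - p‖ < (m + 1) * δ) :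
    (S.card : ℝ) ≤ (m : ℝ) ^ e * (5 ^ (e + 1) - 1) := by
  have hm' : (1 : ℝ) ≤ m := by exact_mod_cast hm
  refine le_trans ?_ (shell_pow_bounds e hm').1
  borelize E
  let μ : Measure E := Measure.addHaar
  have hball (x : E) {r : ℝ} (hr : 0 < r) :
      μ.real (Metric.ball x r) = r ^ (e + 1) * μ.real (Metric.ball 0 1) := by
    rw [measureReal_def, Measure.addHaar_ball_of_pos μ x hr, hE, ENNReal.toReal_mul,
      ENNReal.toReal_ofReal (by positivity), measureReal_def]
  have hpos : 0 < μ.real (Metric.ball (0 : E) 1) :=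
    ENNReal.toReal_pos (Metric.measure_ball_pos μ 0 one_pos).ne' measure_ball_lt_top.ne
  have hdisj : Set.PairwiseDisjoint (↑S) fun k => Metric.ball (y k) (δ / 2) := by
    intro j _ k _ hjk
    refine Metric.ball_disjoint_ball ?_
    rw [dist_eq_norm]
    linarith [hsep j k hjk]
  have hunion := measureReal_biUnion_finset (μ := μ) hdisj
    (fun _ _ => Metric.isOpen_ball.measurableSet) (fun _ _ => measure_ball_lt_top.ne)
  have hsub : (⋃ k ∈ S, Metric.ball (y k) (δ / 2)) ⊆
      Metric.ball p ((m + 3 / 2) * δ) \ Metric.ball p ((m - 1 / 2) * δ) := by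
    intro z hz
    simp only [Set.mem_iUnion, Metric.mem_ball] at hz
    obtain ⟨k, hk, hz⟩ := hz
    obtain ⟨h₁, h₂⟩ := hS k hk
    rw [← dist_eq_norm] at h₁ h₂
    have h₃ := dist_triangle z (y k) p
    have h₄ := dist_triangle (y k) z p
    rw [dist_comm (y k) z] at h₄
    constructor
    · rw [Metric.mem_ball]; linarith
    · rw [Metric.mem_ball, not_lt]; linarith
  have hle := measureReal_mono (μ := μ) hsub
    (measure_ne_top_of_subset Set.sdiff_subset measure_ball_lt_top.ne)
  rw [measureReal_sdiff (Metric.ball_subset_ball (by nlinarith)) Metric.isOpen_ball.measurableSet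
    measure_ball_lt_top.ne, hunion, hball p (by positivity),
    hball p (mul_pos (by linarith) hδ)] at hle
  simp_rw [hball _ (half_pos hδ)] at hle
  rw [Finset.sum_const, nsmul_eq_mul, ← mul_assoc, ← sub_mul] at hle
  have hle := le_of_mul_le_mul_right hle hpos
  have h₁ : ((m : ℝ) + 3 / 2) * δ = (2 * m + 3) * (δ / 2) := by ring
  have h₂ : ((m : ℝ) - 1 / 2) * δ = (2 * m - 1) * (δ / 2) := by ring
  rw [h₁, h₂, mul_pow, mul_pow, ← sub_mul] at hle
  exact le_of_mul_le_mul_right hle (by positivity)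

/-! ### Sums of Gaussians over separated points -/

lemma integrableOn_pow_mul_gaussian (e : ℕ) {c : ℝ} (hc : 0 < c) :
    IntegrableOn (fun r : ℝ => r ^ e * exp (-c * r ^ 2)) (Ioi 0) := by
  have := integrableOn_rpow_mul_exp_neg_mul_sq hc (s := e) (by linarith [e.cast_nonneg (α := ℝ)])
  simpa only [rpow_natCast] using this

lemma integral_pow_mul_gaussian (e : ℕ) {c : ℝ} (hc : 0 < c) :
    ∫ r in Ioi (0 : ℝ), r ^ e * exp (-c * r ^ 2) =
      c ^ (-((e : ℝ) + 1) / 2) * (1 / 2) * Gamma (((e : ℝ) + 1) / 2) := by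
  have := integral_rpow_mul_exp_neg_mul_rpow two_pos (q := e)
    (by linarith [e.cast_nonneg (α := ℝ)]) hc
  simpa only [rpow_natCast, rpow_two] using this

lemma pow_mul_gaussian_le_integral (e : ℕ) {c : ℝ} (hc : 0 < c) {m : ℕ} (hm : 1 ≤ m) :
    (m : ℝ) ^ e * exp (-c * (m : ℝ) ^ 2) ≤
      (e + 1) * ∫ r in Ioc ((m : ℝ) - 1) m, r ^ e * exp (-c * r ^ 2) := by
  have hm' : (1 : ℝ) ≤ m := by exact_mod_cast hm
  have hpow : (m : ℝ) ^ e ≤ (m : ℝ) ^ (e + 1) - ((m : ℝ) - 1) ^ (e + 1) := by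
    have : ((m : ℝ) - 1) ^ e ≤ (m : ℝ) ^ e := pow_le_pow_left₀ (by linarith) (by linarith) _
    rw [pow_succ', pow_succ']
    nlinarith
  have hint : ∫ r in Ioc ((m : ℝ) - 1) m, r ^ e * exp (-c * (m : ℝ) ^ 2) =
      ((m : ℝ) ^ (e + 1) - ((m : ℝ) - 1) ^ (e + 1)) / (e + 1) * exp (-c * (m : ℝ) ^ 2) := by
    rw [integral_mul_const, ← intervalIntegral.integral_of_le (by linarith), integral_pow]
  have hmono : ∫ r in Ioc ((m : ℝ) - 1) m, r ^ e * exp (-c * (m : ℝ) ^ 2) ≤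
      ∫ r in Ioc ((m : ℝ) - 1) m, r ^ e * exp (-c * r ^ 2) := by
    refine setIntegral_mono_on ?_ ?_ measurableSet_Ioc fun r hr => ?_
    · exact ((by fun_prop : Continuous fun r : ℝ => r ^ e * exp (-c * (m : ℝ) ^ 2))
        |>.integrableOn_Icc).mono_set Ioc_subset_Icc_self
    · exact ((by fun_prop : Continuous fun r : ℝ => r ^ e * exp (-c * r ^ 2))
        |>.integrableOn_Icc).mono_set Ioc_subset_Icc_self
    · have hr0 : 0 ≤ r := by linarith [hr.1]
      have : r ^ 2 ≤ (m : ℝ) ^ 2 := pow_le_pow_left₀ hr0 hr.2 2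
      exact mul_le_mul_of_nonneg_left (exp_le_exp.2 (by nlinarith)) (by positivity)
  calc (m : ℝ) ^ e * exp (-c * (m : ℝ) ^ 2)
      ≤ ((m : ℝ) ^ (e + 1) - ((m : ℝ) - 1) ^ (e + 1)) * exp (-c * (m : ℝ) ^ 2) := by gcongr
    _ = (e + 1) * ∫ r in Ioc ((m : ℝ) - 1) m, r ^ e * exp (-c * (m : ℝ) ^ 2) := by
        rw [hint]
        field_simp
    _ ≤ _ := by gcongr

lemma sum_pow_mul_gaussian_le (e : ℕ) {c : ℝ} (hc : 0 < c) (S : Finset ℕ)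
    (hS : ∀ m ∈ S, 1 ≤ m) :
    ∑ m ∈ S, (m : ℝ) ^ e * exp (-c * (m : ℝ) ^ 2) ≤
      (e + 1) * ∫ r in Ioi (0 : ℝ), r ^ e * exp (-c * r ^ 2) := by
  have hint := integrableOn_pow_mul_gaussian e hc
  have hsub : ∀ m ∈ S, Ioc ((m : ℝ) - 1) m ⊆ Ioi 0 := fun m hm r hr => by
    have : (1 : ℝ) ≤ m := by exact_mod_cast hS m hm
    exact lt_of_le_of_lt (by linarith) hr.1
  have hdisj : Set.Pairwise (↑S) (Function.onFun Disjoint fun m : ℕ => Ioc ((m : ℝ) - 1) m) := by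
    intro j _ k _ hjk
    rw [Function.onFun, Set.disjoint_left]
    intro r hj hk
    have h₁ : (j : ℝ) < k + 1 := by linarith [hj.1, hk.2]
    have h₂ : (k : ℝ) < j + 1 := by linarith [hk.1, hj.2]
    norm_cast at h₁ h₂
    omega
  calc _ ≤ ∑ m ∈ S, ((e : ℝ) + 1) * ∫ r in Ioc ((m : ℝ) - 1) m, r ^ e * exp (-c * r ^ 2) :=
        Finset.sum_le_sum fun m hm => pow_mul_gaussian_le_integral e hc (hS m hm)
    _ = (e + 1) * ∫ r in ⋃ m ∈ S, Ioc ((m : ℝ) - 1) m, r ^ e * exp (-c * r ^ 2) := by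
        rw [← Finset.mul_sum, integral_biUnion_finset S (fun _ _ => measurableSet_Ioc) hdisj
          fun m hm => hint.mono_set (hsub m hm)]
    _ ≤ _ := by
        gcongr
        · filter_upwards [ae_restrict_mem measurableSet_Ioi] with r hr
          have : (0 : ℝ) < r := hr
          simp only [Pi.zero_apply]
          positivity
        · exact iUnion₂_subset hsub

lemma sum_gaussian_le {E : Type*} [NormedAddCommGroup E] [NormedSpace ℝ E] [FiniteDimensional ℝ E]
    {e : ℕ} (hE : Module.finrank ℝ E = e + 1) {y : ℕ → E} {δ : ℝ} (hδ : 0 < δ)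
    (hsep : ∀ j k, j ≠ k → δ ≤ ‖y j - y k‖) (p : E) (F : Finset ℕ)
    (hF : ∀ k ∈ F, δ ≤ ‖y k - p‖) {c : ℝ} (hc : 0 < c) :
    ∑ k ∈ F, exp (-c * ‖y k - p‖ ^ 2) ≤ (5 ^ (e + 1) - 1) *
      ((e + 1) * ((c * δ ^ 2) ^ (-((e : ℝ) + 1) / 2) * (1 / 2) * Gamma (((e : ℝ) + 1) / 2))) := by
  have hcδ : 0 < c * δ ^ 2 := by positivity
  have h5 : (0 : ℝ) ≤ 5 ^ (e + 1) - 1 := sub_nonneg.2 (one_le_pow₀ (by norm_num))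
  let q : ℕ → ℕ := fun k => ⌊‖y k - p‖ / δ⌋₊
  have hq1 : ∀ m ∈ F.image q, 1 ≤ m := by
    intro m hm
    obtain ⟨k, hk, rfl⟩ := Finset.mem_image.1 hm
    exact Nat.le_floor (by rw [Nat.cast_one, le_div_iff₀ hδ, one_mul]; exact hF k hk)
  have hql (k : ℕ) : q k * δ ≤ ‖y k - p‖ :=
    (le_div_iff₀ hδ).1 (Nat.floor_le (by positivity))
  have hqu (k : ℕ) : ‖y k - p‖ < (q k + 1) * δ :=
    (div_lt_iff₀ hδ).1 (Nat.lt_floor_add_one _)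
  rw [← integral_pow_mul_gaussian e hcδ]
  calc _ = ∑ m ∈ F.image q, ∑ k ∈ F with q k = m, exp (-c * ‖y k - p‖ ^ 2) :=
        (Finset.sum_fiberwise_of_maps_to (fun k hk => Finset.mem_image_of_mem q hk) _).symm
    _ ≤ ∑ m ∈ F.image q,
          (5 ^ (e + 1) - 1) * ((m : ℝ) ^ e * exp (-(c * δ ^ 2) * (m : ℝ) ^ 2)) := by
        refine Finset.sum_le_sum fun m hm => ?_
        have hcard := card_shell_le hE hδ hsep p (hq1 m hm) {k ∈ F | q k = m} fun k hk => by
          obtain ⟨-, rfl⟩ := Finset.mem_filter.1 hk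
          exact ⟨hql k, hqu k⟩
        calc _ ≤ ∑ k ∈ F with q k = m, exp (-(c * δ ^ 2) * (m : ℝ) ^ 2) := by
              refine Finset.sum_le_sum fun k hk => exp_le_exp.2 ?_
              obtain ⟨-, rfl⟩ := Finset.mem_filter.1 hk
              have := pow_le_pow_left₀ (by positivity) (hql k) 2
              rw [mul_pow] at this
              nlinarith
          _ ≤ (m : ℝ) ^ e * (5 ^ (e + 1) - 1) * exp (-(c * δ ^ 2) * (m : ℝ) ^ 2) := by
              rw [Finset.sum_const, nsmul_eq_mul]
              gcongr
          _ = _ := by ring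
    _ ≤ _ := by
        rw [← Finset.mul_sum]
        gcongr
        exact sum_pow_mul_gaussian_le e hcδ _ hq1

/-! ### The Matérn function as a Gaussian mixture -/

lemma integrableOn_gaussian_mixture {α : ℝ} (hα : 0 < α) (z : ℝ) :
    IntegrableOn (fun s : ℝ => exp (-s) * s ^ (α - 1) * exp (-(1 / (4 * s)) * z ^ 2)) (Ioi 0) := by
  refine (GammaIntegral_convergent hα).mono' ?_ ?_
  · exact Measurable.aestronglyMeasurable (by fun_prop)
  · filter_upwards [ae_restrict_mem measurableSet_Ioi] with s hs
    have hs : 0 < s := hs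
    rw [norm_of_nonneg (by positivity)]
    refine mul_le_of_le_one_right (by positivity) (exp_le_one_iff.2 ?_)
    have : 0 ≤ 1 / (4 * s) * z ^ 2 := by positivity
    linarith

lemma matK_mul_rpow_eq {α z : ℝ} (hα : 0 < α) (hz : 0 < z) :
    2 ^ (1 - α) * matK α z * z ^ α =
      ∫ s in Ioi (0 : ℝ), exp (-s) * s ^ (α - 1) * exp (-(1 / (4 * s)) * z ^ 2) := by
  have himage : (fun t : ℝ => z / 2 * exp (-t)) '' univ = Ioi 0 := by
    ext s
    simp only [image_univ, mem_range, mem_Ioi]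
    constructor
    · rintro ⟨t, rfl⟩
      positivity
    · intro hs
      refine ⟨-log (2 * s / z), ?_⟩
      rw [neg_neg, exp_log (by positivity)]
      field_simp
  have hderiv : ∀ t ∈ (univ : Set ℝ), HasDerivWithinAt (fun t : ℝ => z / 2 * exp (-t))
      (z / 2 * (exp (-t) * -1)) univ t := fun t _ =>
    (((hasDerivAt_neg t).exp).const_mul (z / 2)).hasDerivWithinAt
  have hinj : InjOn (fun t : ℝ => z / 2 * exp (-t)) univ := by
    intro s _ t _ hst
    have := mul_left_cancel₀ (by positivity) hst
    simpa using this
  rw [← himage, integral_image_eq_integral_abs_deriv_smul MeasurableSet.univ hderiv hinj,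
    setIntegral_univ, matK]
  have hpt (t : ℝ) : |z / 2 * (exp (-t) * -1)| • (exp (-(z / 2 * exp (-t))) *
      (z / 2 * exp (-t)) ^ (α - 1) * exp (-(1 / (4 * (z / 2 * exp (-t)))) * z ^ 2)) =
      (z / 2) ^ α * exp (-z * cosh t - α * t) := by
    have h₁ : |z / 2 * (exp (-t) * -1)| = z / 2 * exp (-t) := by
      rw [mul_neg_one, mul_neg, abs_neg, abs_of_pos (by positivity)]
    have h₂ : (z / 2 * exp (-t)) * (z / 2 * exp (-t)) ^ (α - 1) =
        (z / 2) ^ α * exp (-(α * t)) := by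
      rw [← rpow_one_add' (by positivity) (by linarith), add_sub_cancel,
        mul_rpow (by positivity) (by positivity), ← exp_mul]
      congr 2
      ring
    have h₃ : -(1 / (4 * (z / 2 * exp (-t)))) * z ^ 2 = -(z / 2 * exp t) := by
      rw [exp_neg]
      field_simp
      ring
    rw [h₁, smul_eq_mul, h₃, cosh_eq]
    calc _ = ((z / 2 * exp (-t)) * (z / 2 * exp (-t)) ^ (α - 1)) *
          (exp (-(z / 2 * exp (-t))) * exp (-(z / 2 * exp t))) := by ring
      _ = _ := by
        rw [h₂, mul_assoc, ← exp_add, ← exp_add]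
        congr 2
        ring
  simp_rw [hpt]
  rw [integral_const_mul, div_rpow hz.le two_pos.le, rpow_sub two_pos, rpow_one]
  ring

lemma matern_eq_integral {α : ℝ} (hα : 0 < α) {z : ℝ} (hz : 0 ≤ z) :
    matern α z = (Gamma α)⁻¹ *
      ∫ s in Ioi (0 : ℝ), exp (-s) * s ^ (α - 1) * exp (-(1 / (4 * s)) * z ^ 2) := by
  have hΓ := Gamma_pos_of_pos hα
  rcases hz.eq_or_lt with rfl | hz
  · simp [matern, ← Gamma_eq_integral hα, hΓ.ne']
  · rw [matern, if_neg hz.ne', ← matK_mul_rpow_eq hα hz]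
    ring

lemma matern_nonneg {α : ℝ} (hα : 0 < α) {z : ℝ} (hz : 0 ≤ z) : 0 ≤ matern α z := by
  rw [matern_eq_integral hα hz]
  refine mul_nonneg (inv_nonneg.2 (Gamma_pos_of_pos hα).le)
    (setIntegral_nonneg measurableSet_Ioi fun s hs => ?_)
  have hs : 0 < s := hs
  positivity

/-! ### Row sums of the Matérn matrix -/

lemma sum_matern_le {E : Type*} [NormedAddCommGroup E] [NormedSpace ℝ E] [FiniteDimensional ℝ E]
    {d : ℕ} (hd : 1 ≤ d) (hE : Module.finrank ℝ E = d) {y : ℕ → E} {δ : ℝ} (hδ : 0 < δ)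
    (hsep : ∀ j k, j ≠ k → δ ≤ ‖y j - y k‖) (p : E) (F : Finset ℕ)
    (hF : ∀ k ∈ F, δ ≤ ‖y k - p‖) {α : ℝ} (hα : 0 < α) :
    ∑ k ∈ F, matern α ‖y k - p‖ ≤
      (d : ℝ) * 2 ^ (d - 1 : ℕ) * (5 ^ d - 1) * Gamma (α + d / 2) * Gamma (d / 2) /
        (δ ^ d * Gamma α) := by
  obtain ⟨e, rfl⟩ : ∃ e, d = e + 1 := ⟨d - 1, by omega⟩
  have hΓ := Gamma_pos_of_pos hα
  push_cast
  set D : ℝ := (e : ℝ) + 1 with hD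
  have hDpos : 0 < D := by positivity
  set C : ℝ := (5 ^ (e + 1) - 1) * (D * (2 ^ e / δ ^ (e + 1) * Gamma (D / 2))) with hC
  have hpt : ∀ s ∈ Ioi (0 : ℝ),
      ∑ k ∈ F, exp (-s) * s ^ (α - 1) * exp (-(1 / (4 * s)) * ‖y k - p‖ ^ 2) ≤
        C * (exp (-s) * s ^ (α + D / 2 - 1)) := by
    intro s hs
    have hs : 0 < s := hs
    have hpow : (1 / (4 * s) * δ ^ 2) ^ (-D / 2) * (1 / 2) =
        2 ^ e / δ ^ (e + 1) * s ^ (D / 2) := by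
      have h₁ : 1 / (4 * s) * δ ^ 2 = ((2 / δ) ^ 2 * s)⁻¹ := by
        field_simp
        ring
      have h₂ : ((2 / δ) ^ 2) ^ (D / 2) = (2 / δ) ^ (e + 1) := by
        rw [← rpow_two, ← rpow_mul (by positivity), mul_div_cancel₀ _ two_ne_zero, hD,
          ← rpow_natCast]
        push_cast
        rfl
      rw [h₁, inv_rpow (by positivity), neg_div, rpow_neg (by positivity), inv_inv,
        mul_rpow (by positivity) hs.le, h₂, div_pow, pow_succ (2 : ℝ)]
      ring
    have hsum := sum_gaussian_le hE hδ hsep p F hF (c := 1 / (4 * s)) (by positivity)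
    rw [← hD, hpow] at hsum
    rw [← Finset.mul_sum]
    calc _ ≤ exp (-s) * s ^ (α - 1) * ((5 ^ (e + 1) - 1) *
          (D * (2 ^ e / δ ^ (e + 1) * s ^ (D / 2) * Gamma (D / 2)))) := by gcongr
      _ = C * (exp (-s) * (s ^ (α - 1) * s ^ (D / 2))) := by rw [hC]; ring
      _ = _ := by rw [← rpow_add hs]; congr 3; ring
  calc ∑ k ∈ F, matern α ‖y k - p‖
      = (Gamma α)⁻¹ * ∫ s in Ioi (0 : ℝ),
          ∑ k ∈ F, exp (-s) * s ^ (α - 1) * exp (-(1 / (4 * s)) * ‖y k - p‖ ^ 2) := by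
        rw [integral_finsetSum F fun k _ => integrableOn_gaussian_mixture hα _, Finset.mul_sum]
        exact Finset.sum_congr rfl fun k _ => matern_eq_integral hα (norm_nonneg _)
    _ ≤ (Gamma α)⁻¹ * ∫ s in Ioi (0 : ℝ), C * (exp (-s) * s ^ (α + D / 2 - 1)) := by
        refine mul_le_mul_of_nonneg_left ?_ (inv_nonneg.2 hΓ.le)
        exact setIntegral_mono_on
          (integrable_finsetSum F fun k _ => integrableOn_gaussian_mixture hα _)
          ((GammaIntegral_convergent (by positivity)).const_mul C) measurableSet_Ioi hpt
    _ = _ := by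
        rw [integral_const_mul, ← Gamma_eq_integral (by positivity), hC]
        field_simp

/-! ### The Schur test -/

lemma tsum_tsum_mul_mul_le {M : ℕ → ℕ → ℝ} (hM : ∀ j k, 0 ≤ M j k) (hsymm : ∀ j k, M j k = M k j)
    {C : ℝ} (hC : ∀ j (F : Finset ℕ), ∑ k ∈ F, M j k ≤ C) {b : ℕ → ℝ} (hb : ∀ j, 0 ≤ b j)
    (hb2 : Summable fun j => b j ^ 2) :
    ∑' j, ∑' k, M j k * b j * b k ≤ C * ∑' j, b j ^ 2 := by
  have hrow (j : ℕ) : Summable (M j) := summable_of_sum_le (hM j) (hC j)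
  have hrowle (j : ℕ) : ∑' k, M j k ≤ C := Real.tsum_le_of_sum_le (hM j) (hC j)
  let G : ℕ × ℕ → ℝ := fun p => M p.1 p.2 * b p.1 ^ 2
  let f : ℕ × ℕ → ℝ := fun p => M p.1 p.2 * b p.1 * b p.2
  have hG0 : 0 ≤ G := fun p => mul_nonneg (hM _ _) (sq_nonneg _)
  have hf0 : 0 ≤ f := fun p => mul_nonneg (mul_nonneg (hM _ _) (hb _)) (hb _)
  have hGrow (j : ℕ) : ∑' k, G (j, k) ≤ C * b j ^ 2 := by
    simp only [G]
    rw [tsum_mul_right]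
    gcongr
    exact hrowle j
  have hG : Summable G := (summable_prod_of_nonneg hG0).2
    ⟨fun j => (hrow j).mul_right (b j ^ 2), Summable.of_nonneg_of_le
      (fun j => tsum_nonneg fun k => hG0 (j, k)) hGrow (hb2.mul_left C)⟩
  have hG' : Summable (G ∘ Prod.swap) := (Equiv.prodComm ℕ ℕ).summable_iff.2 hG
  have hfG (p : ℕ × ℕ) : f p ≤ (G p + (G ∘ Prod.swap) p) / 2 := by
    simp only [f, G, Function.comp, Prod.fst_swap, Prod.snd_swap, hsymm p.2 p.1]
    nlinarith [mul_nonneg (hM p.1 p.2) (sq_nonneg (b p.1 - b p.2))]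
  have hs : Summable fun p => (G p + (G ∘ Prod.swap) p) / 2 := (hG.add hG').div_const 2
  have hf : Summable f := Summable.of_nonneg_of_le hf0 hfG hs
  calc ∑' j, ∑' k, M j k * b j * b k = ∑' p, f p := hf.tsum_prod.symm
    _ ≤ ∑' p, (G p + (G ∘ Prod.swap) p) / 2 := hf.tsum_le_tsum hfG hs
    _ = ∑' p, G p := by
        rw [tsum_div_const, hG.tsum_add hG', show ∑' p, (G ∘ Prod.swap) p = ∑' p, G p from
          (Equiv.prodComm ℕ ℕ).tsum_eq G]
        ring
    _ = ∑' j, ∑' k, G (j, k) := hG.tsum_prod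
    _ ≤ ∑' j, C * b j ^ 2 := hG.prod.tsum_le_tsum hGrow (hb2.mul_left C)
    _ = C * ∑' j, b j ^ 2 := tsum_mul_left

theorem matern_schoenberg_bound (n d : ℕ) (hn : 0 < n) (hd1 : 1 ≤ d) (hdn : d ≤ n)
    (α : ℝ) (hα : 0 < α)
    (x : ℕ → EuclideanSpace ℝ (Fin n)) (δ : ℝ) (hδ : 0 < δ)
    (hsep : ∀ j k : ℕ, j ≠ k → δ ≤ ‖x j - x k‖)
    (hspan : Module.finrank ℝ (Submodule.span ℝ (Set.range x)) = d)
    (a : ℕ → ℂ) (ha : Summable fun j : ℕ => ‖a j‖ ^ 2) :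
    (∑' j : ℕ, ∑' k : ℕ, matern α ‖x j - x k‖ * ‖a j‖ * ‖a k‖) ≤
      (1 + (d : ℝ) * (2 : ℝ) ^ (d - 1 : ℕ) * ((5 : ℝ) ^ d - 1) *
          Real.Gamma (α + (d : ℝ) / 2) * Real.Gamma ((d : ℝ) / 2) /
            (δ ^ d * Real.Gamma α)) *
        ∑' j : ℕ, ‖a j‖ ^ 2 := by
  let V := Submodule.span ℝ (Set.range x)
  let y : ℕ → V := fun j => ⟨x j, Submodule.subset_span (mem_range_self j)⟩
  have hy (j k : ℕ) : ‖y j - y k‖ = ‖x j - x k‖ := rfl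
  refine tsum_tsum_mul_mul_le (fun j k => matern_nonneg hα (norm_nonneg _))
    (fun j k => by rw [norm_sub_rev]) (fun j F => ?_) (fun j => norm_nonneg _) ha
  have herase := sum_matern_le hd1 hspan hδ (y := y) hsep (y j) (F.erase j)
    (fun k hk => hsep k j (Finset.ne_of_mem_erase hk)) hα
  have hdiag : matern α ‖x j - x j‖ = 1 := by simp [matern]
  calc ∑ k ∈ F, matern α ‖x j - x k‖
      ≤ ∑ k ∈ insert j F, matern α ‖x j - x k‖ :=
        Finset.sum_le_sum_of_subset_of_nonneg (Finset.subset_insert j F)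
          fun k _ _ => matern_nonneg hα (norm_nonneg _)
    _ = 1 + ∑ k ∈ F.erase j, matern α ‖y k - y j‖ := by
        rw [← Finset.add_sum_erase _ _ (Finset.mem_insert_self j F), hdiag,
          Finset.erase_insert_eq_erase]
        simp only [hy, norm_sub_rev (x j)]
    _ ≤ _ := by gcongr
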